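/- Fix s ∈ [0,1]. As T → ∞, the random vector T^{−1/2} Σ_{t=1}^{[Ts]} v_t converges in distribution to the centered Gaussian distribution on ℝ^{d₁d₂} with covariance matrix ∫₀^s (G₂(r) ⊗ G₁(r)) Ω̃ (G₂(r) ⊗ G₁(r))ᵀ dr, where Ω̃ = M − vec(I_d) vec(I_d)ᵀ. -/

import Mathlib

open MeasureTheory ProbabilityTheory Matrix Filter
open scoped Kronecker NNReal Topology

noncomputable section

/-- A function satisfies a Lipschitz condition piecewise on a finite number of
sub-intervals partitioning `(0,1]`. -/
def PiecewiseLipschitz (f : ℝ → ℝ) : Prop :=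
  ∃ (n : ℕ) (a : Fin (n + 1) → ℝ), a 0 = 0 ∧ a (Fin.last n) = 1 ∧ StrictMono a ∧
    ∀ i : Fin n, ∃ K : ℝ≥0, LipschitzOnWith K f (Set.Ioc (a i.castSucc) (a i.succ))

/-- Euclidean norm of a finitely indexed real vector. -/
def euclNorm {ι : Type*} [Fintype ι] (x : ι → ℝ) : ℝ := Real.sqrt (∑ i, x i ^ 2)

/-- The standard Gaussian measure on `ι → ℝ` (iid standard normal coordinates). -/
def stdGaussianPi (ι : Type*) [Fintype ι] : Measure (ι → ℝ) :=
  Measure.pi fun _ => gaussianReal 0 1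

/-- The positive semidefinite square root of a positive semidefinite matrix (the former
Mathlib definition `Matrix.PosSemidef.sqrt`, for real matrices). -/
def Matrix.PosSemidef.sqrt {ι : Type*} [Fintype ι] [DecidableEq ι]
    {A : Matrix ι ι ℝ} (hA : A.PosSemidef) : Matrix ι ι ℝ :=
  hA.1.eigenvectorUnitary.1 * diagonal (Real.sqrt ∘ hA.1.eigenvalues) *
    (star hA.1.eigenvectorUnitary : Matrix ι ι ℝ)

/-- The centered Gaussian distribution on `ι → ℝ` with covariance matrix `Σ`,
realized as the image of the standard Gaussian under the positive semidefinite
square root of `Σ`. -/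
def centeredGaussian {ι : Type*} [Fintype ι] [DecidableEq ι]
    {S : Matrix ι ι ℝ} (hS : S.PosSemidef) : Measure (ι → ℝ) :=
  (stdGaussianPi ι).map hS.sqrt.mulVec

/-- Convergence in distribution (weak convergence of the laws). -/
def TendstoInDistribution {Ω' : Type*} [MeasurableSpace Ω'] (P : Measure Ω')
    {E : Type*} [TopologicalSpace E] [MeasurableSpace E]
    (X : ℕ → Ω' → E) (μ : Measure E) : Prop :=
  ∀ f : BoundedContinuousFunction E ℝ,
    Tendsto (fun T => ∫ ω, f (X T ω) ∂P) atTop (𝓝 (∫ x, f x ∂μ))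

/-- `vec(I_d)` as a vector indexed by pairs: entry `(i,j) ↦ δ_{ij}`. -/
def vecId (d : ℕ) : Fin d × Fin d → ℝ := fun p => if p.1 = p.2 then 1 else 0

/-- `v_{T,t} = u_{2t} ⊗ u_{1t} − vec(Σ¹²(t/T))`, where `u_{1t} = G₁(t/T) ε_t`,
`u_{2t} = G₂(t/T) ε_t` and `vec` is column vectorization (index `(i,j) ↦ A j i`). -/
def vSeq {d₁ d₂ : ℕ} (G₁ : ℝ → Matrix (Fin d₁) (Fin (d₁ + d₂)) ℝ)
    (G₂ : ℝ → Matrix (Fin d₂) (Fin (d₁ + d₂)) ℝ) {Ω' : Type*}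
    (ε : ℕ → Ω' → Fin (d₁ + d₂) → ℝ) (T t : ℕ) (ω : Ω') : Fin d₂ × Fin d₁ → ℝ :=
  fun p =>
    (G₂ ((t : ℝ) / T)).mulVec (ε t ω) p.1 * (G₁ ((t : ℝ) / T)).mulVec (ε t ω) p.2
      - (G₁ ((t : ℝ) / T) * (G₂ ((t : ℝ) / T))ᵀ) p.2 p.1


lemma aux_taylor {p : ℝ} (hp2 : 2 ≤ p) (hp3 : p ≤ 3) (x : ℝ) :
    ‖Complex.exp (x * Complex.I) - (1 + x * Complex.I - (x : ℂ) ^ 2 / 2)‖ ≤ 4 * |x| ^ p := by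
  by_cases hx : |x| ≤ 1
  · have h := Complex.exp_bound (x := (x : ℂ) * Complex.I) (by simpa using hx) (n := 3) (by norm_num)
    have e : (∑ m ∈ Finset.range 3, ((x : ℂ) * Complex.I) ^ m / (m.factorial : ℂ))
        = 1 + x * Complex.I - (x : ℂ) ^ 2 / 2 := by
      simp [Finset.sum_range_succ, mul_pow, Nat.factorial]
      ring
    rw [e] at h
    refine h.trans ?_
    have h3 : |x| ^ (3 : ℕ) ≤ |x| ^ p := by
      rcases eq_or_lt_of_le (abs_nonneg x) with h0 | h0
      · rw [← h0, Real.zero_rpow (by linarith)]; norm_num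
      · rw [← Real.rpow_natCast]
        exact Real.rpow_le_rpow_of_exponent_ge h0 hx (by exact_mod_cast hp3)
    have h4 : (0:ℝ) ≤ |x| ^ 3 := by positivity
    simp [Nat.factorial]
    nlinarith
  · push Not at hx
    have h2 : |x| ^ (2 : ℕ) ≤ |x| ^ p := by
      rw [← Real.rpow_natCast]
      exact Real.rpow_le_rpow_of_exponent_le hx.le (by exact_mod_cast hp2)
    calc _ ≤ ‖Complex.exp (x * Complex.I)‖ + ‖(1 + x * Complex.I - (x : ℂ) ^ 2 / 2)‖ := norm_sub_le _ _
      _ ≤ 1 + (1 + |x| + |x| ^ 2 / 2) := by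
        rw [Complex.norm_exp_ofReal_mul_I]
        gcongr
        refine (norm_sub_le _ _).trans ?_
        gcongr
        · refine (norm_add_le _ _).trans ?_
          simp
        · simp
      _ ≤ 4 * |x| ^ 2 := by nlinarith
      _ ≤ _ := by linarith

lemma aux_exp {a : ℝ} (ha : 0 ≤ a) : |Real.exp (-a) - (1 - a)| ≤ a ^ 2 := by
  have h1 := Real.add_one_le_exp (-a)
  rw [abs_of_nonneg (by linarith)]
  have h2 : Real.exp (-a) ≤ 1 / (1 + a) := by
    rw [Real.exp_neg, ← one_div]
    exact one_div_le_one_div_of_le (by linarith) (by linarith [Real.add_one_le_exp a])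
  have h3 : 1 / (1 + a) ≤ 1 - a + a ^ 2 := by
    rw [div_le_iff₀ (by linarith)]
    nlinarith [pow_nonneg ha 3]
  linarith

lemma aux_pull {Ω' : Type*} {m mΩ : MeasurableSpace Ω'} (hm : m ≤ mΩ) (P : Measure Ω')
    [IsProbabilityMeasure P] {Y : Ω' → ℝ} (hY : Integrable Y P) {c : ℝ}
    (hc : P[Y|m] =ᵐ[P] fun _ => c) {g : Ω' → ℂ} (hg : Measurable[m] g) (hb : ∀ ω, ‖g ω‖ ≤ 1) :
    ∫ ω, g ω * (Y ω : ℂ) ∂P = c * ∫ ω, g ω ∂P := by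
  have hgs : StronglyMeasurable[m] g := hg.stronglyMeasurable
  have hIntg : Integrable (fun ω => Y ω • g ω) P := by
    have := Integrable.bdd_mul (c := 1) (hY.ofReal (𝕜 := ℂ)) (hgs.mono hm).aestronglyMeasurable
      (ae_of_all _ hb)
    refine this.congr (ae_of_all _ fun ω => ?_)
    simp [mul_comm]
  have h := condExp_bilin_of_stronglyMeasurable_right (m := m) (μ := P)
    (ContinuousLinearMap.lsmul ℝ ℝ) hgs (f := Y) (by simpa using hIntg) hY
  have h2 := integral_condExp hm (μ := P) (f := fun ω => Y ω • g ω)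
  have h3 : ∫ ω, (P[fun ω => Y ω • g ω|m]) ω ∂P = ∫ ω, (c : ℂ) * g ω ∂P := by
    apply integral_congr_ae
    filter_upwards [h, hc] with ω h1 h2
    rw [h2] at h1
    simpa using h1
  rw [h3] at h2
  rw [← integral_const_mul, h2]
  congr 1; ext ω
  simp [mul_comm]

/-- core martingale estimate -/
lemma aux_core {Ω' : Type*} {mΩ : MeasurableSpace Ω'} (P : Measure Ω')
    [IsProbabilityMeasure P] (F : Filtration ℕ mΩ) (X : ℕ → Ω' → ℝ)
    (hX : ∀ t, Measurable[F t] (X t)) (σ : ℕ → ℝ) (p : ℝ) (hp2 : 2 ≤ p) (hp3 : p ≤ 3)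
    (hσ : ∀ t, 0 ≤ σ (t + 1))
    (hi1 : ∀ t, Integrable (X (t + 1)) P) (hi2 : ∀ t, Integrable (fun ω => X (t + 1) ω ^ 2) P)
    (hip : ∀ t, Integrable (fun ω => |X (t + 1) ω| ^ p) P)
    (h1 : ∀ t, ∀ g : Ω' → ℂ, Measurable[F t] g → (∀ ω, ‖g ω‖ ≤ 1) →
      ∫ ω, g ω * (X (t + 1) ω : ℂ) ∂P = 0)
    (h2 : ∀ t, ∀ g : Ω' → ℂ, Measurable[F t] g → (∀ ω, ‖g ω‖ ≤ 1) →
      ∫ ω, g ω * ((X (t + 1) ω ^ 2 : ℝ) : ℂ) ∂P = σ (t + 1) * ∫ ω, g ω ∂P) (n : ℕ) :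
    ‖∫ ω, Complex.exp ((∑ t ∈ Finset.Icc 1 n, X t ω : ℝ) * Complex.I) ∂P
      - Complex.exp (-((∑ t ∈ Finset.Icc 1 n, σ t : ℝ) / 2))‖
      ≤ ∑ t ∈ Finset.Icc 1 n, (4 * ∫ ω, |X t ω| ^ p ∂P + σ t ^ 2) := by
  have hXm : ∀ t, Measurable (X t) := fun t => (hX t).mono (F.le t) le_rfl
  induction n with
  | zero => simp
  | succ n ih =>
    set g : Ω' → ℂ := fun ω => Complex.exp ((∑ t ∈ Finset.Icc 1 n, X t ω : ℝ) * Complex.I) with hg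
    have hgm : Measurable[F n] g := by
      have : Measurable[F n] (fun ω => ∑ t ∈ Finset.Icc 1 n, X t ω) := by
        refine Finset.measurable_sum _ (fun t ht => ?_)
        exact (hX t).mono (F.mono (Finset.mem_Icc.1 ht).2) le_rfl
      have hc : Measurable (fun x : ℝ => Complex.exp ((x : ℂ) * Complex.I)) := by fun_prop
      exact hc.comp this
    have hgb : ∀ ω, ‖g ω‖ ≤ 1 := fun ω => (Complex.norm_exp_ofReal_mul_I _).le
    have hgm' : Measurable g := hgm.mono (F.le n) le_rfl
    have hgi : Integrable g P :=
      Integrable.of_bound hgm'.aestronglyMeasurable 1 (ae_of_all _ hgb)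
    have hgi1 : Integrable (fun ω => g ω * (X (n+1) ω : ℂ)) P :=
      Integrable.bdd_mul (c := 1) (hi1 n).ofReal hgm'.aestronglyMeasurable (ae_of_all _ hgb)
    have hgi2 : Integrable (fun ω => g ω * ((X (n+1) ω ^ 2 : ℝ) : ℂ)) P :=
      Integrable.bdd_mul (c := 1) (hi2 n).ofReal hgm'.aestronglyMeasurable (ae_of_all _ hgb)
    set φ : ℂ := ∫ ω, g ω ∂P with hφ
    have hφb : ‖φ‖ ≤ 1 := by
      refine (norm_integral_le_of_norm_le_const (C := 1) (ae_of_all _ hgb)).trans ?_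
      simp
    set R : Ω' → ℂ := fun ω => g ω * (Complex.exp (X (n+1) ω * Complex.I) -
      (1 + X (n+1) ω * Complex.I - (X (n+1) ω : ℂ) ^ 2 / 2)) with hR
    have hRb : ‖∫ ω, R ω ∂P‖ ≤ 4 * ∫ ω, |X (n+1) ω| ^ p ∂P := by
      rw [← integral_const_mul]
      refine norm_integral_le_of_norm_le ((hip n).const_mul 4) (ae_of_all _ fun ω => ?_)
      rw [hR, norm_mul]
      calc _ ≤ 1 * (4 * |X (n+1) ω| ^ p) :=
            mul_le_mul (hgb ω) (aux_taylor hp2 hp3 _) (norm_nonneg _) zero_le_one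
        _ = _ := one_mul _
    have hRm : Measurable R := by
      have := hXm (n+1)
      fun_prop
    have hRi : Integrable R P := by
      refine Integrable.mono' ((hip n).const_mul 4) hRm.aestronglyMeasurable
        (ae_of_all _ fun ω => ?_)
      rw [hR, norm_mul]
      calc _ ≤ 1 * (4 * |X (n+1) ω| ^ p) :=
            mul_le_mul (hgb ω) (aux_taylor hp2 hp3 _) (norm_nonneg _) zero_le_one
        _ = _ := one_mul _
    have key : ∫ ω, Complex.exp ((∑ t ∈ Finset.Icc 1 (n+1), X t ω : ℝ) * Complex.I) ∂P
        = ∫ ω, R ω ∂P + (1 - σ (n+1) / 2) * φ := by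
      have e : ∀ ω, Complex.exp ((∑ t ∈ Finset.Icc 1 (n+1), X t ω : ℝ) * Complex.I)
          = R ω + (g ω + (g ω * (X (n+1) ω : ℂ)) * Complex.I
            - (g ω * ((X (n+1) ω ^ 2 : ℝ) : ℂ)) * (1/2)) := by
        intro ω
        rw [Finset.sum_Icc_succ_top (by omega), Complex.ofReal_add, add_mul, Complex.exp_add]
        simp only [hR, hg]
        push_cast
        ring
      simp_rw [e]
      have i1 : Integrable (fun ω => g ω * (X (n+1) ω : ℂ) * Complex.I) P := hgi1.mul_const _
      have i2 : Integrable (fun ω => g ω * ((X (n+1) ω ^ 2 : ℝ) : ℂ) * (1/2)) P := hgi2.mul_const _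
      have i3 : Integrable (fun ω => g ω + g ω * (X (n+1) ω : ℂ) * Complex.I) P := hgi.add i1
      have i4 : Integrable (fun ω => g ω + g ω * (X (n+1) ω : ℂ) * Complex.I
        - g ω * ((X (n+1) ω ^ 2 : ℝ) : ℂ) * (1/2)) P := i3.sub i2
      rw [integral_add hRi i4, integral_sub i3 i2,
        integral_add hgi i1, integral_mul_const, integral_mul_const,
        h1 n g hgm hgb, h2 n g hgm hgb]
      ring
    rw [key, Finset.sum_Icc_succ_top (by omega), Finset.sum_Icc_succ_top (by omega)]
    set s := ∑ t ∈ Finset.Icc 1 n, σ t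
    set E := ∑ t ∈ Finset.Icc 1 n, (4 * ∫ ω, |X t ω| ^ p ∂P + σ t ^ 2)
    set q := σ (n+1)
    have hq : 0 ≤ q := hσ _
    have hexp : Complex.exp (-((((s + q : ℝ)) : ℂ) / 2)) =
        ((Real.exp (-(q/2)) : ℝ) : ℂ) * Complex.exp (-((s : ℂ) / 2)) := by
      push_cast
      rw [← Complex.exp_add]
      congr 1; ring
    rw [hexp]
    have e2 : ∫ ω, R ω ∂P + (1 - (q:ℂ) / 2) * φ
        - ((Real.exp (-(q/2)) : ℝ) : ℂ) * Complex.exp (-((s : ℂ) / 2))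
        = ∫ ω, R ω ∂P + (-((Real.exp (-(q/2)) - (1 - q/2) : ℝ) : ℂ) * φ
          + ((Real.exp (-(q/2)) : ℝ) : ℂ) * (φ - Complex.exp (-((s : ℂ) / 2)))) := by
      push_cast; ring
    rw [e2]
    refine (norm_add_le _ _).trans ?_
    have b1 : ‖-((Real.exp (-(q/2)) - (1 - q/2) : ℝ) : ℂ) * φ‖ ≤ q ^ 2 := by
      rw [norm_mul, norm_neg, Complex.norm_real, Real.norm_eq_abs]
      have := aux_exp (a := q/2) (by positivity)
      calc _ ≤ (q/2)^2 * 1 := mul_le_mul this hφb (norm_nonneg _) (by positivity)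
        _ ≤ _ := by nlinarith
    have b2 : ‖((Real.exp (-(q/2)) : ℝ) : ℂ) * (φ - Complex.exp (-((s : ℂ) / 2)))‖ ≤ E := by
      rw [norm_mul, Complex.norm_real, Real.norm_eq_abs, abs_of_pos (Real.exp_pos _)]
      have : Real.exp (-(q/2)) ≤ 1 := Real.exp_le_one_iff.2 (by linarith)
      calc _ ≤ 1 * E := mul_le_mul this ih (norm_nonneg _) zero_le_one
        _ = _ := one_mul _
    have := norm_add_le (-((Real.exp (-(q/2)) - (1 - q/2) : ℝ) : ℂ) * φ) (((Real.exp (-(q/2)) : ℝ) : ℂ) * (φ - Complex.exp (-((s : ℂ) / 2))))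
    linarith

/-- Lévy continuity transferred to `ι → ℝ`. -/
lemma aux_levy {ι : Type*} [Fintype ι] {Ω' : Type*} {mΩ : MeasurableSpace Ω'}
    (P : Measure Ω') [IsProbabilityMeasure P] (X : ℕ → Ω' → ι → ℝ) (hX : ∀ n, Measurable (X n))
    (μ : Measure (ι → ℝ)) [IsProbabilityMeasure μ]
    (h : ∀ l : ι → ℝ, Tendsto (fun n => ∫ ω, Complex.exp ((X n ω ⬝ᵥ l : ℝ) * Complex.I) ∂P) atTop
      (𝓝 (∫ x, Complex.exp ((x ⬝ᵥ l : ℝ) * Complex.I) ∂μ))) :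
    TendstoInDistribution P X μ := by
  have hL : Measurable (WithLp.toLp 2 : (ι → ℝ) → EuclideanSpace ℝ ι) := by fun_prop
  let ν : ℕ → ProbabilityMeasure (EuclideanSpace ℝ ι) := fun n =>
    ⟨P.map (fun ω => WithLp.toLp 2 (X n ω)),
      Measure.isProbabilityMeasure_map (hL.comp (hX n)).aemeasurable⟩
  let ν₀ : ProbabilityMeasure (EuclideanSpace ℝ ι) :=
    ⟨μ.map (WithLp.toLp 2), Measure.isProbabilityMeasure_map hL.aemeasurable⟩
  have hcont : ∀ l : EuclideanSpace ℝ ι, Continuous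
      (fun x : EuclideanSpace ℝ ι => Complex.exp ((inner ℝ x l : ℝ) * Complex.I)) := by
    intro l; fun_prop
  have hν : Tendsto ν atTop (𝓝 ν₀) := by
    rw [ProbabilityMeasure.tendsto_iff_tendsto_charFun]
    intro l
    have hl := h (WithLp.ofLp l)
    have e0 : ∀ x : ι → ℝ, inner ℝ (WithLp.toLp 2 x) l = x ⬝ᵥ WithLp.ofLp l := by
      intro x
      simp [PiLp.inner_apply, dotProduct, mul_comm]
    have e1 : charFun (ν₀ : Measure (EuclideanSpace ℝ ι)) l
        = ∫ x, Complex.exp ((x ⬝ᵥ WithLp.ofLp l : ℝ) * Complex.I) ∂μ := by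
      change charFun (μ.map (WithLp.toLp 2)) l = _
      rw [charFun_apply, integral_map hL.aemeasurable (hcont l).aestronglyMeasurable]
      simp_rw [e0]
    have e2 : ∀ n, charFun (ν n : Measure (EuclideanSpace ℝ ι)) l
        = ∫ ω, Complex.exp ((X n ω ⬝ᵥ WithLp.ofLp l : ℝ) * Complex.I) ∂P := by
      intro n
      change charFun (P.map (fun ω => WithLp.toLp 2 (X n ω))) l = _
      rw [charFun_apply, integral_map (φ := fun ω => WithLp.toLp 2 (X n ω)) (hL.comp (hX n)).aemeasurable (hcont l).aestronglyMeasurable]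
      simp_rw [e0]
    rw [e1]
    simp_rw [e2]
    exact hl
  rw [ProbabilityMeasure.tendsto_iff_forall_integral_tendsto] at hν
  intro f
  have hf := hν (f.compContinuous ⟨WithLp.ofLp, PiLp.continuous_ofLp 2 _⟩)
  have e1 : ∫ x, (f.compContinuous ⟨WithLp.ofLp, PiLp.continuous_ofLp 2 _⟩) x
      ∂(ν₀ : Measure (EuclideanSpace ℝ ι)) = ∫ x, f x ∂μ := by
    change ∫ x, _ ∂(μ.map (WithLp.toLp 2)) = _
    rw [integral_map hL.aemeasurable (BoundedContinuousFunction.continuous _).aestronglyMeasurable]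
    rfl
  have e2 : ∀ n, ∫ x, (f.compContinuous ⟨WithLp.ofLp, PiLp.continuous_ofLp 2 _⟩) x
      ∂(ν n : Measure (EuclideanSpace ℝ ι)) = ∫ ω, f (X n ω) ∂P := by
    intro n
    change ∫ x, _ ∂(P.map (fun ω => WithLp.toLp 2 (X n ω))) = _
    rw [integral_map (φ := fun ω => WithLp.toLp 2 (X n ω)) (hL.comp (hX n)).aemeasurable
      (BoundedContinuousFunction.continuous _).aestronglyMeasurable]
    rfl
  rw [e1] at hf
  simp_rw [e2] at hf
  exact hf

lemma aux_sqrt_mul {ι : Type*} [Fintype ι] [DecidableEq ι] {S : Matrix ι ι ℝ}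
    (hS : S.PosSemidef) : hS.sqrt * hS.sqrtᵀ = S := by
  have hsp := hS.1.spectral_theorem
  have hU : (star hS.1.eigenvectorUnitary : Matrix ι ι ℝ) * hS.1.eigenvectorUnitary.1 = 1 := by
    simp
  have hd : diagonal (Real.sqrt ∘ hS.1.eigenvalues) * diagonal (Real.sqrt ∘ hS.1.eigenvalues)
      = diagonal hS.1.eigenvalues := by
    rw [diagonal_mul_diagonal]
    congr 1; ext i
    exact Real.mul_self_sqrt (hS.eigenvalues_nonneg i)
  have hst : (star hS.1.eigenvectorUnitary : Matrix ι ι ℝ) = (hS.1.eigenvectorUnitary.1)ᵀ := by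
    rw [star_eq_conjTranspose]
    exact conjTranspose_eq_transpose_of_trivial _
  have ht : hS.sqrtᵀ = hS.sqrt := by
    unfold Matrix.PosSemidef.sqrt
    rw [hst]
    simp [transpose_mul, mul_assoc]
  rw [ht]
  conv_rhs => rw [hsp]
  rw [Unitary.conjStarAlgAut_apply]
  unfold Matrix.PosSemidef.sqrt
  calc _ = hS.1.eigenvectorUnitary.1 * (diagonal (Real.sqrt ∘ hS.1.eigenvalues) *
      ((star hS.1.eigenvectorUnitary : Matrix ι ι ℝ) * hS.1.eigenvectorUnitary.1) *
       diagonal (Real.sqrt ∘ hS.1.eigenvalues)) * (star hS.1.eigenvectorUnitary : Matrix ι ι ℝ) := by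
        simp only [mul_assoc]
    _ = _ := by
        rw [hU, mul_one, hd]
        rfl

instance aux_prob {ι : Type*} [Fintype ι] [DecidableEq ι] {S : Matrix ι ι ℝ}
    (hS : S.PosSemidef) : IsProbabilityMeasure (centeredGaussian hS) := by
  unfold centeredGaussian stdGaussianPi
  refine Measure.isProbabilityMeasure_map ?_
  have : Continuous hS.sqrt.mulVec := by fun_prop
  exact this.aemeasurable

lemma aux_gauss {ι : Type*} [Fintype ι] [DecidableEq ι] {S : Matrix ι ι ℝ}
    (hS : S.PosSemidef) (l : ι → ℝ) :
    ∫ x, Complex.exp ((x ⬝ᵥ l : ℝ) * Complex.I) ∂(centeredGaussian hS)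
      = Complex.exp (-((l ⬝ᵥ S *ᵥ l : ℝ) / 2)) := by
  have hc : Continuous hS.sqrt.mulVec := by fun_prop
  have hc2 : Continuous (fun x : ι → ℝ => Complex.exp ((x ⬝ᵥ l : ℝ) * Complex.I)) := by
    unfold dotProduct; fun_prop
  unfold centeredGaussian stdGaussianPi
  rw [integral_map hc.aemeasurable hc2.aestronglyMeasurable]
  set a := hS.sqrtᵀ *ᵥ l with ha
  have e : ∀ x : ι → ℝ, Complex.exp ((hS.sqrt *ᵥ x ⬝ᵥ l : ℝ) * Complex.I)
      = ∏ i, Complex.exp ((a i : ℂ) * (x i : ℂ) * Complex.I) := by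
    intro x
    have : hS.sqrt *ᵥ x ⬝ᵥ l = ∑ i, a i * x i := by
      rw [dotProduct_comm, dotProduct_mulVec, ← mulVec_transpose, ← ha]; rfl
    rw [this, ← Complex.exp_sum]
    push_cast
    rw [Finset.sum_mul]
  simp_rw [e]
  rw [integral_fintype_prod_eq_prod (f := fun i (x : ℝ) => Complex.exp ((a i : ℂ) * (x : ℂ) * Complex.I))]
  simp_rw [← charFun_apply_real, charFun_gaussianReal]
  rw [← Complex.exp_sum]
  congr 1
  have : l ⬝ᵥ S *ᵥ l = ∑ i, a i * a i := by
    conv_lhs => rw [← aux_sqrt_mul hS]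
    rw [← mulVec_mulVec, ← ha, dotProduct_mulVec, ← mulVec_transpose, ← ha]; rfl
  rw [this]
  push_cast
  rw [Finset.sum_div, ← Finset.sum_neg_distrib]
  refine Finset.sum_congr rfl fun i _ => ?_
  simp
  ring

lemma aux_pl {f : ℝ → ℝ} (hf : PiecewiseLipschitz f) :
    ∀ᵐ r ∂(volume.restrict (Set.Ioc (0 : ℝ) 1)), ContinuousAt f r := by
  obtain ⟨n, a, ha0, ha1, -, hlip⟩ := hf
  have hfin : (Set.range a).Countable := (Set.finite_range a).countable
  have hae : ∀ᵐ r ∂(volume : Measure ℝ), r ∉ Set.range a := hfin.ae_notMem _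
  rw [ae_restrict_iff' measurableSet_Ioc]
  filter_upwards [hae] with r hr hr01
  by_contra hcon
  have key : ∀ i : Fin (n + 1), a i < r := by
    intro i
    induction i using Fin.induction with
    | zero => rw [ha0]; exact hr01.1
    | succ i ih =>
      by_contra hle
      push Not at hle
      have hlt : r < a i.succ := lt_of_le_of_ne hle (fun h => hr ⟨_, h.symm⟩)
      obtain ⟨K, hK⟩ := hlip i
      exact hcon (hK.continuousOn.continuousAt (Ioc_mem_nhds ih hlt))
  have := key (Fin.last n)
  rw [ha1] at this
  exact absurd hr01.2 (not_le.2 this)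

lemma aux_riemann (h : ℝ → ℝ) (C : ℝ) (hb : ∀ r ∈ Set.Ioc (0 : ℝ) 1, |h r| ≤ C)
    (hc : ∀ᵐ r ∂(volume.restrict (Set.Ioc (0 : ℝ) 1)), ContinuousAt h r)
    (s : ℝ) (hs : s ∈ Set.Icc (0 : ℝ) 1) :
    Tendsto (fun T : ℕ => ∑ t ∈ Finset.Icc 1 ⌊(T : ℝ) * s⌋₊, h ((t : ℝ) / T) * (T : ℝ)⁻¹) atTop
      (𝓝 (∫ r in Set.Ioc (0 : ℝ) s, h r)) := by
  let F : ℕ → ℝ → ℝ := fun T r => ∑ t ∈ Finset.Icc 1 ⌊(T : ℝ) * s⌋₊,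
    (Set.Ioc (((t : ℝ) - 1) / T) ((t : ℝ) / T)).indicator (fun _ => h ((t : ℝ) / T)) r
  have hfl : ∀ T : ℕ, ⌊(T : ℝ) * s⌋₊ ≤ T := fun T => by
    apply Nat.floor_le_of_le
    nlinarith [hs.2, (Nat.cast_nonneg T : (0:ℝ) ≤ T)]
  have hval : ∀ T : ℕ, 1 ≤ T → ∀ r ∈ Set.Ioc (0:ℝ) 1,
      F T r = if ⌈(T:ℝ) * r⌉₊ ≤ ⌊(T : ℝ) * s⌋₊ then h ((⌈(T:ℝ) * r⌉₊ : ℝ) / T) else 0 := by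
    intro T hT r hr
    have hT0 : (0:ℝ) < T := by exact_mod_cast hT
    have hk : 1 ≤ ⌈(T:ℝ) * r⌉₊ := Nat.one_le_iff_ne_zero.2 (by
      have : 0 < ⌈(T:ℝ) * r⌉₊ := Nat.ceil_pos.2 (mul_pos hT0 hr.1)
      omega)
    have e : ∀ t ∈ Finset.Icc 1 ⌊(T : ℝ) * s⌋₊,
        (Set.Ioc (((t : ℝ) - 1) / T) ((t : ℝ) / T)).indicator (fun _ => h ((t : ℝ) / T)) r
        = if ⌈(T:ℝ) * r⌉₊ = t then h ((t : ℝ) / T) else 0 := by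
      intro t ht
      have ht1 : 1 ≤ t := (Finset.mem_Icc.1 ht).1
      have : r ∈ Set.Ioc (((t : ℝ) - 1) / T) ((t : ℝ) / T) ↔ ⌈(T:ℝ) * r⌉₊ = t := by
        rw [Nat.ceil_eq_iff (by omega), Set.mem_Ioc, div_lt_iff₀ hT0, le_div_iff₀ hT0]
        push_cast [ht1]
        rw [mul_comm r]
      rw [Set.indicator_apply]
      simp only [this]
    simp only [F]
    rw [Finset.sum_congr rfl e, Finset.sum_ite_eq]
    simp [hk]
  have hIntg : ∀ T : ℕ, 1 ≤ T → ∫ r in Set.Ioc (0:ℝ) 1, F T r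
      = ∑ t ∈ Finset.Icc 1 ⌊(T : ℝ) * s⌋₊, h ((t : ℝ) / T) * (T : ℝ)⁻¹ := by
    intro T hT
    have hT0 : (0:ℝ) < T := by exact_mod_cast hT
    simp only [F]
    rw [integral_finsetSum]
    · refine Finset.sum_congr rfl fun t ht => ?_
      have ht1 : (1:ℝ) ≤ t := by exact_mod_cast (Finset.mem_Icc.1 ht).1
      have ht2 : (t:ℝ) ≤ T := by exact_mod_cast (Finset.mem_Icc.1 ht).2.trans (hfl T)
      rw [setIntegral_indicator measurableSet_Ioc]
      have : Set.Ioc (0:ℝ) 1 ∩ Set.Ioc (((t : ℝ) - 1) / T) ((t : ℝ) / T)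
          = Set.Ioc (((t : ℝ) - 1) / T) ((t : ℝ) / T) := by
        apply Set.inter_eq_right.2
        apply Set.Ioc_subset_Ioc
        · exact div_nonneg (by linarith) hT0.le
        · exact (div_le_one hT0).2 ht2
      rw [this, setIntegral_const, measureReal_def, Real.volume_Ioc, ENNReal.toReal_ofReal]
      · simp only [smul_eq_mul]; field_simp; ring
      · rw [← sub_div]; apply div_nonneg _ hT0.le; linarith
    · intro t _
      exact (integrable_const _).indicator measurableSet_Ioc
  have hlim : ∫ r in Set.Ioc (0:ℝ) s, h r
      = ∫ r in Set.Ioc (0:ℝ) 1, (Set.Ioc (0:ℝ) s).indicator h r := by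
    rw [setIntegral_indicator measurableSet_Ioc,
      Set.inter_eq_right.2 (Set.Ioc_subset_Ioc_right hs.2)]
  rw [hlim]
  have hmain : Tendsto (fun T : ℕ => ∫ r in Set.Ioc (0:ℝ) 1, F T r) atTop
      (𝓝 (∫ r in Set.Ioc (0:ℝ) 1, (Set.Ioc (0:ℝ) s).indicator h r)) := by
    refine tendsto_integral_filter_of_dominated_convergence (fun _ => C) ?_ ?_ (integrable_const _) ?_
    · refine Eventually.of_forall fun T => ?_
      refine Measurable.aestronglyMeasurable ?_
      refine Finset.measurable_sum _ fun t _ => ?_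
      exact measurable_const.indicator measurableSet_Ioc
    · filter_upwards [eventually_ge_atTop 1] with T hT
      filter_upwards [ae_restrict_mem measurableSet_Ioc] with r hr
      have hT0 : (0:ℝ) < T := by exact_mod_cast hT
      rw [hval T hT r hr, Real.norm_eq_abs]
      have hC : 0 ≤ C := (abs_nonneg _).trans (hb r hr)
      split_ifs with hk
      · apply hb
        constructor
        · apply div_pos _ hT0
          exact_mod_cast Nat.ceil_pos.2 (mul_pos hT0 hr.1)
        · rw [div_le_one hT0]
          exact_mod_cast hk.trans (hfl T)
      · simpa using hC
    · have hne : ∀ᵐ r ∂(volume.restrict (Set.Ioc (0:ℝ) 1)), r ≠ s :=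
        ae_restrict_of_ae (Measure.ae_ne volume s)
      filter_upwards [ae_restrict_mem measurableSet_Ioc, hc, hne] with r hr hcr hrs
      rcases lt_or_gt_of_ne hrs with hlt | hgt
      · rw [Set.indicator_of_mem (show r ∈ Set.Ioc 0 s from ⟨hr.1, hlt.le⟩)]
        have hk : Tendsto (fun T : ℕ => (⌈(T:ℝ) * r⌉₊ : ℝ) / T) atTop (𝓝 r) := by
          have := (tendsto_nat_ceil_mul_div_atTop (R := ℝ) hr.1.le).comp
            (tendsto_natCast_atTop_atTop (R := ℝ))
          refine this.congr fun T => ?_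
          simp [mul_comm]
        refine (hcr.tendsto.comp hk).congr' ?_
        have hbig : ∀ᶠ T : ℕ in atTop, 1 ≤ (T:ℝ) * (s - r) := by
          have : Tendsto (fun T : ℕ => (T:ℝ) * (s - r)) atTop atTop :=
            (tendsto_natCast_atTop_atTop (R := ℝ)).atTop_mul_const (by linarith)
          exact this.eventually_ge_atTop 1
        filter_upwards [eventually_ge_atTop 1, hbig] with T hT hT2
        rw [hval T hT r hr, if_pos]
        · rfl
        · apply Nat.le_floor
          have := Nat.ceil_lt_add_one (a := (T:ℝ) * r) (by have := hr.1; positivity)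
          nlinarith
      · rw [Set.indicator_of_notMem (fun hm => absurd hm.2 (not_le.2 hgt))]
        refine tendsto_const_nhds.congr' ?_
        filter_upwards [eventually_ge_atTop 1] with T hT
        have hT0 : (0:ℝ) < T := by exact_mod_cast hT
        rw [hval T hT r hr, if_neg]
        intro hle
        have h1 := Nat.le_ceil ((T:ℝ) * r)
        have h2 := Nat.floor_le (a := (T:ℝ) * s) (mul_nonneg hT0.le hs.1)
        have h3 : ((⌈(T:ℝ) * r⌉₊ : ℕ) : ℝ) ≤ (⌊(T : ℝ) * s⌋₊ : ℕ) := by exact_mod_cast hle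
        have : (T:ℝ) * s < T * r := by nlinarith
        linarith
  refine hmain.congr' ?_
  filter_upwards [eventually_ge_atTop 1] with T hT
  exact hIntg T hT

lemma aux_q {Ω' : Type*} {mΩ : MeasurableSpace Ω'} (P : Measure Ω') [IsProbabilityMeasure P]
    (N : Ω' → ℝ) (hN0 : ∀ ω, 0 ≤ N ω) (hN : Measurable N) (m C : ℝ) (hm : 1 < m)
    (hi : Integrable (fun ω => N ω ^ (4 * m)) P) (hC : ∫ ω, N ω ^ (4 * m) ∂P ≤ C)
    (q : ℝ) (hq : q ≤ 2 * m) :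
    Integrable (fun ω => (1 + N ω ^ 2) ^ q) P ∧
      ∫ ω, (1 + N ω ^ 2) ^ q ∂P ≤ 2 ^ (2 * m) * (1 + C) := by
  have hb : ∀ ω, (1 + N ω ^ 2) ^ q ≤ 2 ^ (2 * m) * (1 + N ω ^ (4 * m)) := by
    intro ω
    have h1 : (1:ℝ) ≤ 1 + N ω ^ 2 := by nlinarith [sq_nonneg (N ω)]
    refine (Real.rpow_le_rpow_of_exponent_le h1 hq).trans ?_
    have hpos : 0 ≤ N ω ^ (4 * m) := Real.rpow_nonneg (hN0 ω) _
    rcases le_total (N ω) 1 with h | h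
    · calc (1 + N ω ^ 2) ^ (2 * m) ≤ 2 ^ (2 * m) := by
            apply Real.rpow_le_rpow (by linarith) _ (by linarith)
            nlinarith [hN0 ω]
        _ ≤ _ := by
            have : (0:ℝ) ≤ 2 ^ (2 * m) := by positivity
            nlinarith
    · calc (1 + N ω ^ 2) ^ (2 * m) ≤ (2 * N ω ^ 2) ^ (2 * m) := by
            apply Real.rpow_le_rpow (by linarith) _ (by linarith)
            nlinarith [hN0 ω]
        _ = 2 ^ (2 * m) * N ω ^ (4 * m) := by
            rw [Real.mul_rpow (by norm_num) (by positivity), ← Real.rpow_natCast,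
              ← Real.rpow_mul (hN0 ω)]
            congr 2; push_cast; ring
        _ ≤ _ := by
            have : (0:ℝ) ≤ 2 ^ (2 * m) := by positivity
            nlinarith
  have hi2 : Integrable (fun ω => 2 ^ (2 * m) * (1 + N ω ^ (4 * m))) P :=
    ((integrable_const (1:ℝ)).add hi).const_mul _
  have hIntg : Integrable (fun ω => (1 + N ω ^ 2) ^ q) P := by
    refine hi2.mono' ?_ (ae_of_all _ fun ω => ?_)
    · exact Measurable.aestronglyMeasurable (by fun_prop)
    · rw [Real.norm_of_nonneg (Real.rpow_nonneg (by positivity) _)]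
      exact hb ω
  refine ⟨hIntg, (integral_mono hIntg hi2 hb).trans ?_⟩
  rw [integral_const_mul, integral_add (integrable_const _) hi]
  simp only [integral_const, probReal_univ, smul_eq_mul, one_mul]
  gcongr

/-- centered products -/
def auxW {d : ℕ} (e : Fin d → ℝ) (a : Fin d × Fin d) : ℝ := e a.1 * e a.2 - vecId d a

lemma auxW_le {d : ℕ} (e : Fin d → ℝ) (a : Fin d × Fin d) :
    |auxW e a| ≤ 1 + euclNorm e ^ 2 := by
  unfold auxW euclNorm vecId
  rw [Real.sq_sqrt (Finset.sum_nonneg fun i _ => sq_nonneg _)]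
  have h1 : ∀ i, e i ^ 2 ≤ ∑ i, e i ^ 2 := fun i =>
    Finset.single_le_sum (f := fun i => e i ^ 2) (fun i _ => sq_nonneg _) (Finset.mem_univ i)
  have h2 := h1 a.1
  have h3 := h1 a.2
  have : |e a.1 * e a.2| ≤ ∑ i, e i ^ 2 := by
    rw [abs_le]; constructor <;> nlinarith [sq_nonneg (e a.1 + e a.2), sq_nonneg (e a.1 - e a.2)]
  refine (abs_sub _ _).trans ?_
  have h5 : |(if a.1 = a.2 then (1:ℝ) else 0)| ≤ 1 := by split_ifs <;> simp
  linarith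

lemma auxW_meas {d : ℕ} (a : Fin d × Fin d) : Measurable (fun e : Fin d → ℝ => auxW e a) := by
  unfold auxW; fun_prop

lemma auxN_meas {d : ℕ} : Measurable (fun e : Fin d → ℝ => euclNorm e) := by
  unfold euclNorm; fun_prop

lemma auxY_le {d : ℕ} (e : Fin d → ℝ) (A : Fin d × Fin d → ℝ) :
    |A ⬝ᵥ auxW e| ≤ (∑ a, |A a|) * (1 + euclNorm e ^ 2) := by
  unfold dotProduct
  refine (Finset.abs_sum_le_sum_abs _ _).trans ?_
  rw [Finset.sum_mul]
  refine Finset.sum_le_sum fun a _ => ?_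
  rw [abs_mul]
  exact mul_le_mul_of_nonneg_left (auxW_le e a) (abs_nonneg _)

section
variable {Ω' : Type*} {m mΩ : MeasurableSpace Ω'}

lemma aux_Yp (P : Measure Ω') [IsProbabilityMeasure P] {d : ℕ} (e : Ω' → Fin d → ℝ)
    (he : Measurable e) (p K : ℝ) (hp : 0 ≤ p)
    (hq : Integrable (fun ω => (1 + euclNorm (e ω) ^ 2) ^ p) P)
    (hK : ∫ ω, (1 + euclNorm (e ω) ^ 2) ^ p ∂P ≤ K) (A : Fin d × Fin d → ℝ) (B : ℝ)
    (hA : ∑ a, |A a| ≤ B) :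
    Integrable (fun ω => |A ⬝ᵥ auxW (e ω)| ^ p) P ∧
      ∫ ω, |A ⬝ᵥ auxW (e ω)| ^ p ∂P ≤ B ^ p * K := by
  have hB0 : 0 ≤ B := le_trans (Finset.sum_nonneg fun a _ => abs_nonneg _) hA
  have hb : ∀ ω, |A ⬝ᵥ auxW (e ω)| ^ p ≤ B ^ p * (1 + euclNorm (e ω) ^ 2) ^ p := by
    intro ω
    rw [← Real.mul_rpow hB0 (by positivity)]
    refine Real.rpow_le_rpow (abs_nonneg _) ((auxY_le _ _).trans ?_) hp
    exact mul_le_mul_of_nonneg_right hA (by positivity)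
  have hm : Measurable (fun ω => |A ⬝ᵥ auxW (e ω)| ^ p) := by
    have : Measurable (fun ω => A ⬝ᵥ auxW (e ω)) := by
      unfold dotProduct
      exact Finset.measurable_sum _ fun a _ => ((auxW_meas a).comp he).const_mul _
    have h2 : Measurable (fun x : ℝ => |x| ^ p) := by fun_prop
    exact h2.comp this
  have hi : Integrable (fun ω => |A ⬝ᵥ auxW (e ω)| ^ p) P := by
    refine (hq.const_mul (B ^ p)).mono' hm.aestronglyMeasurable (ae_of_all _ fun ω => ?_)
    rw [Real.norm_of_nonneg (Real.rpow_nonneg (abs_nonneg _) _)]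
    exact hb ω
  refine ⟨hi, (integral_mono hi (hq.const_mul _) hb).trans ?_⟩
  rw [integral_const_mul]
  exact mul_le_mul_of_nonneg_left hK (Real.rpow_nonneg hB0 _)

lemma aux_cond (hm : m ≤ mΩ) (P : Measure Ω') [IsProbabilityMeasure P] {d : ℕ}
    (e : Ω' → Fin d → ℝ) (he : Measurable e)
    (hq1 : Integrable (fun ω => (1 + euclNorm (e ω) ^ 2)) P)
    (hq2 : Integrable (fun ω => (1 + euclNorm (e ω) ^ 2) ^ 2) P)
    (hcov : ∀ i j, P[fun ω => e ω i * e ω j|m] =ᵐ[P] fun _ => if i = j then (1 : ℝ) else 0)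
    (M : Matrix (Fin d × Fin d) (Fin d × Fin d) ℝ)
    (hM : ∀ p q : Fin d × Fin d,
      P[fun ω => e ω p.1 * e ω q.1 * (e ω p.2 * e ω q.2)|m] =ᵐ[P] fun _ => M p q)
    (A : Fin d × Fin d → ℝ) (g : Ω' → ℂ) (hg : Measurable[m] g) (hgb : ∀ ω, ‖g ω‖ ≤ 1) :
    ∫ ω, g ω * ((A ⬝ᵥ auxW (e ω) : ℝ) : ℂ) ∂P = 0 ∧
    ∫ ω, g ω * (((A ⬝ᵥ auxW (e ω)) ^ 2 : ℝ) : ℂ) ∂P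
      = ((A ⬝ᵥ (M - vecMulVec (vecId d) (vecId d)) *ᵥ A : ℝ) : ℂ) * ∫ ω, g ω ∂P := by
  have hgm : Measurable g := hg.mono hm le_rfl
  have hei : ∀ i, Measurable fun ω => e ω i := fun i => (measurable_pi_apply i).comp he
  have h1le : ∀ i j ω, |e ω i * e ω j| ≤ 1 + euclNorm (e ω) ^ 2 := by
    intro i j ω
    unfold euclNorm
    rw [Real.sq_sqrt (Finset.sum_nonneg fun i _ => sq_nonneg _)]
    have h1 : ∀ i, e ω i ^ 2 ≤ ∑ i, e ω i ^ 2 := fun i =>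
      Finset.single_le_sum (f := fun i => e ω i ^ 2) (fun i _ => sq_nonneg _) (Finset.mem_univ i)
    have h2 := h1 i
    have h3 := h1 j
    rw [abs_le]
    constructor <;> nlinarith [sq_nonneg (e ω i + e ω j), sq_nonneg (e ω i - e ω j)]
  have hint2 : ∀ i j, Integrable (fun ω => e ω i * e ω j) P := fun i j =>
    hq1.mono' ((hei i).mul (hei j)).aestronglyMeasurable (ae_of_all _ (h1le i j))
  have hint4 : ∀ p q : Fin d × Fin d,
      Integrable (fun ω => e ω p.1 * e ω q.1 * (e ω p.2 * e ω q.2)) P := fun p q => by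
    refine hq2.mono' (((hei _).mul (hei _)).mul ((hei _).mul (hei _))).aestronglyMeasurable
      (ae_of_all _ fun ω => ?_)
    rw [Real.norm_eq_abs, abs_mul, sq]
    exact mul_le_mul (h1le _ _ ω) (h1le _ _ ω) (abs_nonneg _) (by positivity)
  have hgi : Integrable g P :=
    Integrable.of_bound hgm.aestronglyMeasurable 1 (ae_of_all _ hgb)
  have hgY : ∀ Y : Ω' → ℝ, Integrable Y P → Integrable (fun ω => g ω * (Y ω : ℂ)) P :=
    fun Y hY => Integrable.bdd_mul (c := 1) hY.ofReal hgm.aestronglyMeasurable (ae_of_all _ hgb)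
  set φ := ∫ ω, g ω ∂P
  have k2 : ∀ i j, ∫ ω, g ω * ((e ω i * e ω j : ℝ) : ℂ) ∂P = (vecId d (i, j) : ℂ) * φ := by
    intro i j
    rw [aux_pull hm P (hint2 i j) (hcov i j) hg hgb]
    rfl
  have k4 : ∀ p q : Fin d × Fin d, ∫ ω, g ω * ((e ω p.1 * e ω q.1 * (e ω p.2 * e ω q.2) : ℝ) : ℂ) ∂P
      = (M p q : ℂ) * φ := by
    intro p q
    rw [aux_pull hm P (hint4 p q) (hM p q) hg hgb]
  have hWi : ∀ a, Integrable (fun ω => auxW (e ω) a) P := fun a =>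
    (hint2 a.1 a.2).sub (integrable_const _)
  have hWWi : ∀ a b, Integrable (fun ω => auxW (e ω) a * auxW (e ω) b) P := fun a b => by
    refine hq2.mono' (((auxW_meas a).comp he).mul ((auxW_meas b).comp he)).aestronglyMeasurable
      (ae_of_all _ fun ω => ?_)
    rw [Real.norm_eq_abs, abs_mul, sq]
    exact mul_le_mul (auxW_le _ _) (auxW_le _ _) (abs_nonneg _) (by positivity)
  have w1 : ∀ a, ∫ ω, g ω * (auxW (e ω) a : ℂ) ∂P = 0 := by
    intro a
    have : ∀ ω, g ω * (auxW (e ω) a : ℂ) = g ω * ((e ω a.1 * e ω a.2 : ℝ) : ℂ)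
        - g ω * (vecId d a : ℂ) := by
      intro ω; unfold auxW; push_cast; ring
    simp_rw [this]
    rw [integral_sub (hgY _ (hint2 _ _)) (hgi.mul_const _), k2, integral_mul_const]
    ring
  have w2 : ∀ a b, ∫ ω, g ω * ((auxW (e ω) a * auxW (e ω) b : ℝ) : ℂ) ∂P
      = ((M a b - vecId d a * vecId d b : ℝ) : ℂ) * φ := by
    intro a b
    have : ∀ ω, g ω * ((auxW (e ω) a * auxW (e ω) b : ℝ) : ℂ)
        = g ω * ((e ω a.1 * e ω b.1 * (e ω a.2 * e ω b.2) : ℝ) : ℂ)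
          - (g ω * ((e ω a.1 * e ω a.2 : ℝ) : ℂ)) * (vecId d b : ℂ)
          - (g ω * (auxW (e ω) b : ℂ)) * (vecId d a : ℂ) := by
      intro ω; unfold auxW; push_cast; ring
    simp_rw [this]
    have i1 := hgY _ (hint4 a b)
    have i2 := (hgY _ (hint2 a.1 a.2)).mul_const (vecId d b : ℂ)
    have i3 := (hgY _ (hWi b)).mul_const (vecId d a : ℂ)
    have i12 : Integrable (fun ω => g ω * ((e ω a.1 * e ω b.1 * (e ω a.2 * e ω b.2) : ℝ) : ℂ)
          - (g ω * ((e ω a.1 * e ω a.2 : ℝ) : ℂ)) * (vecId d b : ℂ)) P := i1.sub i2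
    rw [integral_sub i12 i3, integral_sub i1 i2, integral_mul_const, integral_mul_const, w1 b, k4, k2]
    push_cast; ring
  constructor
  · have : ∀ ω, g ω * ((A ⬝ᵥ auxW (e ω) : ℝ) : ℂ) = ∑ a, (A a : ℂ) * (g ω * (auxW (e ω) a : ℂ)) := by
      intro ω; unfold dotProduct; push_cast; rw [Finset.mul_sum]
      exact Finset.sum_congr rfl fun a _ => by ring
    simp_rw [this]
    rw [integral_finsetSum _ fun a _ => (hgY _ (hWi a)).const_mul _]
    simp_rw [integral_const_mul, w1]
    simp
  · have : ∀ ω, g ω * (((A ⬝ᵥ auxW (e ω)) ^ 2 : ℝ) : ℂ)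
        = ∑ a, ∑ b, ((A a * A b : ℝ) : ℂ) * (g ω * ((auxW (e ω) a * auxW (e ω) b : ℝ) : ℂ)) := by
      intro ω; unfold dotProduct; rw [sq, Finset.sum_mul_sum]; push_cast; rw [Finset.mul_sum]
      refine Finset.sum_congr rfl fun a _ => ?_
      rw [Finset.mul_sum]
      exact Finset.sum_congr rfl fun b _ => by ring
    simp_rw [this]
    rw [integral_finsetSum _ fun a _ => integrable_finsetSum _ fun b _ =>
      (hgY _ (hWWi a b)).const_mul _]
    have : ∀ a, ∫ ω, ∑ b, ((A a * A b : ℝ) : ℂ) * (g ω * ((auxW (e ω) a * auxW (e ω) b : ℝ) : ℂ)) ∂P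
        = ∑ b, ((A a * A b : ℝ) : ℂ) * (((M a b - vecId d a * vecId d b : ℝ) : ℂ) * φ) := by
      intro a
      rw [integral_finsetSum _ fun b _ => (hgY _ (hWWi a b)).const_mul _]
      simp_rw [integral_const_mul, w2]
    simp_rw [this]
    simp only [dotProduct, mulVec, Matrix.sub_apply, vecMulVec_apply]
    push_cast
    rw [Finset.sum_mul]
    refine Finset.sum_congr rfl fun a _ => ?_
    rw [Finset.mul_sum, Finset.sum_mul]
    exact Finset.sum_congr rfl fun b _ => by ring
end

theorem statement6
    (d₁ d₂ : ℕ) (hd₁ : 1 ≤ d₁) (hd₂ : 1 ≤ d₂)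
    (G₁ : ℝ → Matrix (Fin d₁) (Fin (d₁ + d₂)) ℝ)
    (G₂ : ℝ → Matrix (Fin d₂) (Fin (d₁ + d₂)) ℝ)
    (hG₁bdd : ∃ C : ℝ, ∀ r ∈ Set.Ioc (0 : ℝ) 1, ∀ i j, |G₁ r i j| ≤ C)
    (hG₂bdd : ∃ C : ℝ, ∀ r ∈ Set.Ioc (0 : ℝ) 1, ∀ i j, |G₂ r i j| ≤ C)
    (hG₁lip : ∀ i j, PiecewiseLipschitz fun r => G₁ r i j)
    (hG₂lip : ∀ i j, PiecewiseLipschitz fun r => G₂ r i j)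
    {Ω' : Type*} {mΩ : MeasurableSpace Ω'} (P : Measure Ω') [IsProbabilityMeasure P]
    (F : Filtration ℕ mΩ)
    (ε : ℕ → Ω' → Fin (d₁ + d₂) → ℝ)
    (hmeas : ∀ t, Measurable (ε t))
    (hadapted : ∀ t, Measurable[F t] (ε t))
    (hcondzero : ∀ t, P[ε (t + 1)|F t] =ᵐ[P] 0)
    (hcondcov : ∀ t i j,
      P[fun ω => ε (t + 1) ω i * ε (t + 1) ω j|F t]
        =ᵐ[P] fun _ => if i = j then (1 : ℝ) else 0)
    (M : Matrix (Fin (d₁ + d₂) × Fin (d₁ + d₂)) (Fin (d₁ + d₂) × Fin (d₁ + d₂)) ℝ)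
    (hcondM : ∀ t, ∀ p q : Fin (d₁ + d₂) × Fin (d₁ + d₂),
      P[fun ω => ε (t + 1) ω p.1 * ε (t + 1) ω q.1 * (ε (t + 1) ω p.2 * ε (t + 1) ω q.2)|F t]
        =ᵐ[P] fun _ => M p q)
    (hmom : ∃ m : ℝ, 1 < m ∧ (∀ t, Integrable (fun ω => euclNorm (ε t ω) ^ (4 * m)) P) ∧
      ∃ C : ℝ, ∀ t, ∫ ω, euclNorm (ε t ω) ^ (4 * m) ∂P ≤ C)
    (s : ℝ) (hs : s ∈ Set.Icc (0 : ℝ) 1) :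
    ∃ hOm : (Matrix.of fun p q : Fin d₂ × Fin d₁ =>
        ∫ r in Set.Ioc (0 : ℝ) s,
          ((G₂ r ⊗ₖ G₁ r) * (M - Matrix.vecMulVec (vecId (d₁ + d₂)) (vecId (d₁ + d₂)))
            * (G₂ r ⊗ₖ G₁ r)ᵀ) p q).PosSemidef,
      TendstoInDistribution P
        (fun T : ℕ => fun ω =>
          (Real.sqrt T)⁻¹ • ∑ t ∈ Finset.Icc 1 ⌊(T : ℝ) * s⌋₊, vSeq G₁ G₂ ε T t ω)
        (centeredGaussian hOm) := by
  classical
  obtain ⟨C₁, hC₁⟩ := hG₁bdd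
  obtain ⟨C₂, hC₂⟩ := hG₂bdd
  obtain ⟨m, hm1, hmi, C, hmC⟩ := hmom
  set Om := M - Matrix.vecMulVec (vecId (d₁ + d₂)) (vecId (d₁ + d₂)) with hOmdef
  set S : Matrix (Fin d₂ × Fin d₁) (Fin d₂ × Fin d₁) ℝ := Matrix.of fun p q : Fin d₂ × Fin d₁ =>
        ∫ r in Set.Ioc (0 : ℝ) s, ((G₂ r ⊗ₖ G₁ r) * Om * (G₂ r ⊗ₖ G₁ r)ᵀ) p q with hSdef
  -- moments
  have hN0 : ∀ t ω, 0 ≤ euclNorm (ε t ω) := fun t ω => Real.sqrt_nonneg _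
  have hQ : ∀ t q, q ≤ 2 * m → Integrable (fun ω => (1 + euclNorm (ε t ω) ^ 2) ^ q) P ∧
      ∫ ω, (1 + euclNorm (ε t ω) ^ 2) ^ q ∂P ≤ 2 ^ (2 * m) * (1 + C) := fun t q hq =>
    aux_q P (fun ω => euclNorm (ε t ω)) (hN0 t) (auxN_meas.comp (hmeas t)) m C hm1 (hmi t) (hmC t)
      q hq
  set K : ℝ := 2 ^ (2 * m) * (1 + C) with hK
  have hq1 : ∀ t, Integrable (fun ω => (1 + euclNorm (ε t ω) ^ 2)) P := fun t => by
    have := (hQ t 1 (by linarith)).1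
    simpa using this
  have hq2 : ∀ t, Integrable (fun ω => (1 + euclNorm (ε t ω) ^ 2) ^ 2) P := fun t => by
    have := (hQ t 2 (by linarith)).1
    simpa using this
  have hcond := fun t => aux_cond (F.le t) P (ε (t + 1)) (hmeas (t + 1)) (hq1 _) (hq2 _)
    (hcondcov t) M (hcondM t)
  -- Riemann sums of the entries
  have hR : ∀ p q, Tendsto (fun T : ℕ => ∑ t ∈ Finset.Icc 1 ⌊(T : ℝ) * s⌋₊,
      ((G₂ ((t : ℝ) / T) ⊗ₖ G₁ ((t : ℝ) / T)) * Om * (G₂ ((t : ℝ) / T) ⊗ₖ G₁ ((t : ℝ) / T))ᵀ) p q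
        * (T : ℝ)⁻¹) atTop (𝓝 (S p q)) := by
    intro p q
    let Φ : (Fin d₂ → Fin (d₁ + d₂) → ℝ) × (Fin d₁ → Fin (d₁ + d₂) → ℝ) → ℝ := fun z =>
      ((Matrix.of z.1 ⊗ₖ Matrix.of z.2) * Om * (Matrix.of z.1 ⊗ₖ Matrix.of z.2)ᵀ) p q
    have hΦ : Continuous Φ := by
      simp only [Φ, Matrix.mul_apply, Matrix.kroneckerMap_apply, Matrix.transpose_apply,
        Matrix.of_apply]
      fun_prop
    have hcpt : IsCompact ((Set.Icc (fun _ _ => -C₂) (fun _ _ => C₂) ×ˢ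
        Set.Icc (fun _ _ => -C₁) (fun _ _ => C₁)) :
        Set ((Fin d₂ → Fin (d₁ + d₂) → ℝ) × (Fin d₁ → Fin (d₁ + d₂) → ℝ))) :=
      isCompact_Icc.prod isCompact_Icc
    obtain ⟨CC, hCC⟩ := hcpt.exists_bound_of_continuousOn hΦ.continuousOn
    refine aux_riemann (fun r => Φ (G₂ r, G₁ r)) CC ?_ ?_ s hs
    · intro r hr
      apply hCC
      refine ⟨⟨fun i j => ?_, fun i j => ?_⟩, ⟨fun i j => ?_, fun i j => ?_⟩⟩
      · exact (abs_le.1 (hC₂ r hr i j)).1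
      · exact (abs_le.1 (hC₂ r hr i j)).2
      · exact (abs_le.1 (hC₁ r hr i j)).1
      · exact (abs_le.1 (hC₁ r hr i j)).2
    · have c1 : ∀ᵐ r ∂(volume.restrict (Set.Ioc (0 : ℝ) 1)), ∀ i j,
          ContinuousAt (fun r => G₁ r i j) r := by
        rw [ae_all_iff]; intro i; rw [ae_all_iff]; intro j; exact aux_pl (hG₁lip i j)
      have c2 : ∀ᵐ r ∂(volume.restrict (Set.Ioc (0 : ℝ) 1)), ∀ i j,
          ContinuousAt (fun r => G₂ r i j) r := by
        rw [ae_all_iff]; intro i; rw [ae_all_iff]; intro j; exact aux_pl (hG₂lip i j)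
      filter_upwards [c1, c2] with r h1 h2
      refine hΦ.continuousAt.comp (f := fun r => ((G₂ r, G₁ r) :
        (Fin d₂ → Fin (d₁ + d₂) → ℝ) × (Fin d₁ → Fin (d₁ + d₂) → ℝ))) ?_
      refine ContinuousAt.prodMk ?_ ?_
      · exact continuousAt_pi.2 fun i => continuousAt_pi.2 fun j => h2 i j
      · exact continuousAt_pi.2 fun i => continuousAt_pi.2 fun j => h1 i j
  -- the coefficient vectors and conditional variances
  let A : (Fin d₂ × Fin d₁ → ℝ) → ℕ → ℕ → Fin (d₁ + d₂) × Fin (d₁ + d₂) → ℝ := fun l T t =>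
    (Real.sqrt T)⁻¹ • ((G₂ ((t : ℝ) / T) ⊗ₖ G₁ ((t : ℝ) / T))ᵀ *ᵥ l)
  let σ : (Fin d₂ × Fin d₁ → ℝ) → ℕ → ℕ → ℝ := fun l T t => A l T t ⬝ᵥ Om *ᵥ A l T t
  have hσeq : ∀ l T t, σ l T t = ∑ p, ∑ q, l p * l q *
      (((G₂ ((t : ℝ) / T) ⊗ₖ G₁ ((t : ℝ) / T)) * Om * (G₂ ((t : ℝ) / T) ⊗ₖ G₁ ((t : ℝ) / T))ᵀ) p q
        * (T : ℝ)⁻¹) := by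
    intro l T t
    simp only [σ, A]
    set Kr := G₂ ((t : ℝ) / T) ⊗ₖ G₁ ((t : ℝ) / T)
    have hT : (Real.sqrt T)⁻¹ * (Real.sqrt T)⁻¹ = (T : ℝ)⁻¹ := by
      rw [← mul_inv, Real.mul_self_sqrt (Nat.cast_nonneg T)]
    rw [mulVec_smul, smul_dotProduct, dotProduct_smul, smul_eq_mul, smul_eq_mul, ← mul_assoc, hT]
    have : (Krᵀ *ᵥ l) ⬝ᵥ Om *ᵥ (Krᵀ *ᵥ l) = l ⬝ᵥ (Kr * Om * Krᵀ) *ᵥ l := by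
      rw [← mulVec_mulVec, ← mulVec_mulVec, dotProduct_mulVec l Kr, ← mulVec_transpose]
    rw [this]
    simp only [dotProduct, mulVec, Finset.mul_sum]
    refine Finset.sum_congr rfl fun p _ => Finset.sum_congr rfl fun q _ => ?_
    ring
  have hσlim : ∀ l, Tendsto (fun T : ℕ => ∑ t ∈ Finset.Icc 1 ⌊(T : ℝ) * s⌋₊, σ l T t) atTop
      (𝓝 (l ⬝ᵥ S *ᵥ l)) := by
    intro l
    have e1 : l ⬝ᵥ S *ᵥ l = ∑ p, ∑ q, l p * l q * S p q := by
      simp only [dotProduct, mulVec, Finset.mul_sum]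
      refine Finset.sum_congr rfl fun p _ => Finset.sum_congr rfl fun q _ => ?_
      ring
    rw [e1]
    have := tendsto_finsetSum Finset.univ fun p _ => tendsto_finsetSum Finset.univ fun q _ =>
      (hR p q).const_mul (l p * l q)
    refine this.congr fun T => ?_
    simp_rw [hσeq, Finset.mul_sum]
    rw [Finset.sum_comm]
    conv_rhs => rw [Finset.sum_comm]
    rw [Finset.sum_comm]
    refine Finset.sum_congr rfl fun p _ => ?_
    rw [Finset.sum_comm]
  have hσint : ∀ l T t, σ l T (t + 1) = ∫ ω, (A l T (t + 1) ⬝ᵥ auxW (ε (t + 1) ω)) ^ 2 ∂P := by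
    intro l T t
    have h := (hcond t (A l T (t + 1)) (fun _ => 1) measurable_const (by simp)).2
    simp only [one_mul, integral_const, probReal_univ, one_smul, mul_one] at h
    rw [integral_complex_ofReal] at h
    exact (Complex.ofReal_injective h).symm
  have hσ0 : ∀ l T t, 0 ≤ σ l T (t + 1) := by
    intro l T t
    rw [hσint]
    exact integral_nonneg fun ω => sq_nonneg _
  -- positive semidefiniteness
  have hMs : ∀ a b, M a b = M b a := by
    intro a b
    have h1 := hcondM 0 a b
    have h2 := hcondM 0 b a
    have e : (fun ω => ε (0 + 1) ω b.1 * ε (0 + 1) ω a.1 * (ε (0 + 1) ω b.2 * ε (0 + 1) ω a.2))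
        = fun ω => ε (0 + 1) ω a.1 * ε (0 + 1) ω b.1 * (ε (0 + 1) ω a.2 * ε (0 + 1) ω b.2) := by
      ext ω; ring
    rw [e] at h2
    obtain ⟨ω, hω⟩ := (h1.symm.trans h2).exists
    exact hω
  have hOms : Omᵀ = Om := by
    ext a b
    rw [hOmdef]
    simp only [Matrix.transpose_apply, Matrix.sub_apply, Matrix.vecMulVec_apply]
    rw [hMs b a]; ring
  have hSpsd : S.PosSemidef := by
    refine Matrix.PosSemidef.of_dotProduct_mulVec_nonneg ?_ fun l => ?_
    · ext p q
      rw [Matrix.conjTranspose_apply, star_trivial]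
      simp only [hSdef, Matrix.of_apply]
      congr 1; ext r
      rw [← Matrix.transpose_apply (_ * _ * _)]
      simp only [Matrix.transpose_mul, Matrix.transpose_transpose, hOms, Matrix.mul_assoc]
    · rw [star_trivial]
      refine ge_of_tendsto' (hσlim l) fun T => Finset.sum_nonneg fun t ht => ?_
      obtain ⟨k, rfl⟩ : ∃ k, t = k + 1 := ⟨t - 1, by have := (Finset.mem_Icc.1 ht).1; omega⟩
      exact hσ0 l T k
  refine ⟨hSpsd, ?_⟩
  -- the normalized sums
  have hv : ∀ T t ω, vSeq G₁ G₂ ε T t ω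
      = (G₂ ((t : ℝ) / T) ⊗ₖ G₁ ((t : ℝ) / T)) *ᵥ auxW (ε t ω) := by
    intro T t ω
    ext p
    simp only [vSeq, mulVec, dotProduct, auxW, vecId, Matrix.kroneckerMap_apply, Matrix.mul_apply,
      Matrix.transpose_apply, mul_sub, Finset.sum_sub_distrib, Finset.sum_mul_sum,
      Fintype.sum_prod_type]
    congr 1
    · refine Finset.sum_congr rfl fun i _ => Finset.sum_congr rfl fun j _ => ?_
      ring
    · refine Finset.sum_congr rfl fun i _ => ?_
      simp [mul_comm]
  have hdot : ∀ l T ω, ((Real.sqrt (T : ℕ))⁻¹ • ∑ t ∈ Finset.Icc 1 ⌊(T : ℝ) * s⌋₊,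
      vSeq G₁ G₂ ε T t ω) ⬝ᵥ l
      = ∑ t ∈ Finset.Icc 1 ⌊(T : ℝ) * s⌋₊, A l T t ⬝ᵥ auxW (ε t ω) := by
    intro l T ω
    rw [smul_dotProduct, sum_dotProduct, smul_eq_mul, Finset.mul_sum]
    refine Finset.sum_congr rfl fun t _ => ?_
    simp only [A]
    rw [hv, smul_dotProduct, smul_eq_mul, mulVec_transpose, ← dotProduct_mulVec, dotProduct_comm l]
  have hYmeas : ∀ (B : Fin (d₁ + d₂) × Fin (d₁ + d₂) → ℝ) t,
      Measurable[F t] (fun ω => B ⬝ᵥ auxW (ε t ω)) := by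
    intro B t
    have h2 : Measurable (fun e : Fin (d₁ + d₂) → ℝ => B ⬝ᵥ auxW e) := by
      unfold dotProduct
      exact Finset.measurable_sum _ fun a _ => (auxW_meas a).const_mul _
    exact h2.comp (hadapted t)
  have hVmeas : ∀ T t, Measurable (fun ω => vSeq G₁ G₂ ε T t ω) := by
    intro T t
    simp_rw [hv]
    refine measurable_pi_lambda _ fun p => ?_
    exact (hYmeas ((G₂ ((t : ℝ) / T) ⊗ₖ G₁ ((t : ℝ) / T)) p) t).mono (F.le t) le_rfl
  refine aux_levy P _ (fun T => ?_) _ fun l => ?_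
  · have h1 : Measurable (fun ω => ∑ t ∈ Finset.Icc 1 ⌊(T : ℝ) * s⌋₊, vSeq G₁ G₂ ε T t ω) :=
      Finset.measurable_sum _ fun t _ => hVmeas T t
    exact h1.const_smul ((Real.sqrt T)⁻¹)
  rw [aux_gauss]
  simp_rw [hdot]
  set p : ℝ := min (2 * m) 3 with hp
  have hp2 : 2 < p := lt_min (by linarith) (by norm_num)
  have hp3 : p ≤ 3 := min_le_right _ _
  have hpm : p ≤ 2 * m := min_le_left _ _
  have hlim2 : Tendsto (fun T : ℕ =>
      Complex.exp (-((∑ t ∈ Finset.Icc 1 ⌊(T : ℝ) * s⌋₊, σ l T t : ℝ) / 2))) atTop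
      (𝓝 (Complex.exp (-((l ⬝ᵥ S *ᵥ l : ℝ) / 2)))) := by
    have hc : Continuous (fun x : ℝ => Complex.exp (-((x : ℂ) / 2))) := by fun_prop
    exact (hc.tendsto _).comp (hσlim l)
  refine tendsto_of_tendsto_of_dist hlim2 ?_
  -- coefficient bound
  obtain ⟨B, hB0, hB⟩ : ∃ B : ℝ, 0 ≤ B ∧ ∀ T t : ℕ, 1 ≤ t → t ≤ T →
      ∑ a, |A l T t a| ≤ (Real.sqrt T)⁻¹ * B := by
    refine ⟨∑ a : Fin (d₁ + d₂) × Fin (d₁ + d₂), ∑ p : Fin d₂ × Fin d₁, |C₂| * |C₁| * |l p|,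
      by positivity, ?_⟩
    intro T t ht1 htT
    have hr : (t : ℝ) / T ∈ Set.Ioc (0:ℝ) 1 := by
      have h1 : (0:ℝ) < t := by exact_mod_cast ht1
      have h2 : (t:ℝ) ≤ T := by exact_mod_cast htT
      exact ⟨by have := h1.trans_le h2; positivity, (div_le_one (h1.trans_le h2)).2 h2⟩
    rw [Finset.mul_sum]
    refine Finset.sum_le_sum fun a _ => ?_
    simp only [A, Pi.smul_apply, smul_eq_mul, abs_mul]
    rw [abs_of_nonneg (by positivity : (0:ℝ) ≤ (Real.sqrt T)⁻¹)]
    refine mul_le_mul_of_nonneg_left ?_ (by positivity)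
    simp only [mulVec, dotProduct, Matrix.transpose_apply, Matrix.kroneckerMap_apply]
    refine (Finset.abs_sum_le_sum_abs _ _).trans (Finset.sum_le_sum fun p _ => ?_)
    rw [abs_mul, abs_mul]
    refine mul_le_mul_of_nonneg_right (mul_le_mul ((hC₂ _ hr _ _).trans (le_abs_self _))
      ((hC₁ _ hr _ _).trans (le_abs_self _)) (abs_nonneg _) (abs_nonneg _)) (abs_nonneg _)
  have hK0 : 0 ≤ K := by
    refine le_trans ?_ (hQ 0 1 (by linarith)).2
    exact integral_nonneg fun ω => by positivity
  have hcore : ∀ T : ℕ, 1 ≤ T →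
      dist (Complex.exp (-((∑ t ∈ Finset.Icc 1 ⌊(T : ℝ) * s⌋₊, σ l T t : ℝ) / 2)))
        (∫ ω, Complex.exp ((∑ t ∈ Finset.Icc 1 ⌊(T : ℝ) * s⌋₊, A l T t ⬝ᵥ auxW (ε t ω) : ℝ)
          * Complex.I) ∂P)
      ≤ (4 * (B ^ p * K)) * (T : ℝ) ^ (-(p / 2 - 1)) + (B ^ 2 * K) ^ 2 * (T : ℝ)⁻¹ := by
    intro T hT
    have hT0 : (0:ℝ) < T := by exact_mod_cast hT
    have hYp := fun t => aux_Yp P (ε t) (hmeas t) p K (by linarith) (hQ t p hpm).1 (hQ t p hpm).2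
      (A l T t)
    have hY2 := fun t => aux_Yp P (ε t) (hmeas t) 2 K (by norm_num) (hQ t 2 (by linarith)).1
      (hQ t 2 (by linarith)).2 (A l T t)
    have hY1 := fun t => aux_Yp P (ε t) (hmeas t) 1 K (by norm_num) (hQ t 1 (by linarith)).1
      (hQ t 1 (by linarith)).2 (A l T t)
    have core := aux_core P F (fun t ω => A l T t ⬝ᵥ auxW (ε t ω)) (fun t => hYmeas _ t)
      (σ l T) p hp2.le hp3 (hσ0 l T)
      (fun t => by
        have := (hY1 (t + 1) _ le_rfl).1
        simp only [Real.rpow_one] at this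
        exact (integrable_norm_iff
          ((hYmeas _ (t + 1)).mono (F.le _) le_rfl).aestronglyMeasurable).1 this)
      (fun t => by
        have := (hY2 (t + 1) _ le_rfl).1
        simpa only [Real.rpow_two, sq_abs] using this)
      (fun t => (hYp (t + 1) _ le_rfl).1)
      (fun t g hg hgb => (hcond t (A l T (t + 1)) g hg hgb).1)
      (fun t g hg hgb => (hcond t (A l T (t + 1)) g hg hgb).2)
      ⌊(T : ℝ) * s⌋₊
    rw [dist_comm, dist_eq_norm]
    refine core.trans ?_
    have hfl : ⌊(T : ℝ) * s⌋₊ ≤ T := by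
      apply Nat.floor_le_of_le
      nlinarith [hs.2]
    have hterm : ∀ t ∈ Finset.Icc 1 ⌊(T : ℝ) * s⌋₊,
        4 * ∫ ω, |A l T t ⬝ᵥ auxW (ε t ω)| ^ p ∂P + σ l T t ^ 2
        ≤ 4 * (((Real.sqrt T)⁻¹ * B) ^ p * K) + ((T:ℝ)⁻¹ * (B ^ 2 * K)) ^ 2 := by
      intro t ht
      have ht1 := (Finset.mem_Icc.1 ht).1
      have htT := (Finset.mem_Icc.1 ht).2.trans hfl
      have b1 := (hYp t _ (hB T t ht1 htT)).2
      have b2 := (hY2 t _ (hB T t ht1 htT)).2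
      obtain ⟨k, rfl⟩ : ∃ k, t = k + 1 := ⟨t - 1, by omega⟩
      have b3 : σ l T (k + 1) ≤ (T:ℝ)⁻¹ * (B ^ 2 * K) := by
        rw [hσint]
        simp only [Real.rpow_two, sq_abs] at b2
        refine b2.trans (le_of_eq ?_)
        rw [mul_pow, inv_pow, Real.sq_sqrt hT0.le]; ring
      have := pow_le_pow_left₀ (hσ0 l T k) b3 2
      linarith
    refine (Finset.sum_le_card_nsmul _ _ _ hterm).trans ?_
    rw [Nat.card_Icc, nsmul_eq_mul]
    have hcard : ((⌊(T : ℝ) * s⌋₊ + 1 - 1 : ℕ) : ℝ) ≤ T := by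
      rw [Nat.add_sub_cancel]; exact_mod_cast hfl
    refine (mul_le_mul_of_nonneg_right hcard (by positivity)).trans (le_of_eq ?_)
    have hpow : ((Real.sqrt T)⁻¹ * B) ^ p = (T:ℝ) ^ (-(p / 2)) * B ^ p := by
      rw [Real.mul_rpow (by positivity) hB0, Real.sqrt_eq_rpow, ← Real.rpow_neg hT0.le,
        ← Real.rpow_mul hT0.le]
      congr 2; ring
    have hpow2 : (T : ℝ) ^ (-(p / 2 - 1)) = T * (T:ℝ) ^ (-(p / 2)) := by
      rw [show -(p / 2 - 1) = 1 + -(p / 2) by ring, Real.rpow_add hT0, Real.rpow_one]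
    rw [hpow, hpow2]
    field_simp
  have hz : Tendsto (fun T : ℕ => (4 * (B ^ p * K)) * (T : ℝ) ^ (-(p / 2 - 1))
      + (B ^ 2 * K) ^ 2 * (T : ℝ)⁻¹) atTop (𝓝 0) := by
    have z1 : Tendsto (fun T : ℕ => (T : ℝ) ^ (-(p / 2 - 1))) atTop (𝓝 0) :=
      (tendsto_rpow_neg_atTop (by linarith)).comp tendsto_natCast_atTop_atTop
    have z2 : Tendsto (fun T : ℕ => (T : ℝ)⁻¹) atTop (𝓝 0) := tendsto_inv_atTop_nhds_zero_nat
    simpa using (z1.const_mul (4 * (B ^ p * K))).add (z2.const_mul ((B ^ 2 * K) ^ 2))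
  refine squeeze_zero' (Eventually.of_forall fun T => dist_nonneg) ?_ hz
  filter_upwards [eventually_ge_atTop 1] with T hT
  exact hcore T hT

end
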